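/- Let μ be a positive Radon measure on ℝ^{n+1} with K(μ) := sup over all balls B_r(x) ⊂ ℝ^{n+1} of r^{-n} μ(B_r(x)) finite. Then there is a constant c(n) depending only on n such that |∫_{ℝ^{n+1}} φ dμ| ≤ c(n) K(μ) ∫_{ℝ^{n+1}} |∇φ| dL^{n+1} for all φ ∈ C¹_c(ℝ^{n+1}). -/

import Mathlib

open MeasureTheory Filter Topology
open scoped ENNReal NNReal

noncomputable section

abbrev Euc (n : ℕ) := EuclideanSpace ℝ (Fin n)

/-- The coefficient matrix of the minimal surface operator linearized at slope `z`. -/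
def matA {n : ℕ} (z : Euc n) (i j : Fin n) : ℝ :=
  (1 / Real.sqrt (1 + ‖z‖ ^ 2)) * ((if i = j then (1:ℝ) else 0) - z i * z j / (1 + ‖z‖ ^ 2))

section TraceInequality

variable {E : Type*} [NormedAddCommGroup E] [NormedSpace ℝ E]

theorem enorm_sub_le_lintegral_fderiv_segment {v : E → ℝ} (hv : ContDiff ℝ 1 v) (x y : E) :
    ‖v x - v y‖ₑ ≤
      ∫⁻ s in Set.Icc (0 : ℝ) 1, ‖fderiv ℝ v (s • x + (1 - s) • y)‖ₑ * ‖x - y‖ₑ := by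
  have hγ : ∀ s : ℝ, HasDerivAt (fun s : ℝ => s • x + (1 - s) • y) (x - y) s := fun s => by
    have h₁ := (hasDerivAt_id s).smul_const x
    have h₂ := ((hasDerivAt_id s).const_sub 1).smul_const y
    refine (h₁.add h₂).congr_deriv ?_
    simp [sub_eq_add_neg]
  have hd : ∀ s : ℝ, HasDerivAt (fun s : ℝ => v (s • x + (1 - s) • y))
      (fderiv ℝ v (s • x + (1 - s) • y) (x - y)) s := fun s =>
    ((hv.differentiable one_ne_zero).differentiableAt.hasFDerivAt).comp_hasDerivAt s (hγ s)
  have hc : ContDiff ℝ 1 (fun s : ℝ => v (s • x + (1 - s) • y)) := by fun_prop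
  have h := enorm_sub_le_lintegral_deriv_of_contDiffOn_Icc (hc.contDiffOn (s := Set.Icc 0 1))
    zero_le_one
  simp only [one_smul, sub_self, zero_smul, add_zero, zero_add, sub_zero] at h
  refine h.trans (lintegral_mono fun s => ?_)
  rw [(hd s).deriv]
  exact ContinuousLinearMap.le_opENorm _ _

theorem exists_deriv_smoothTransition_bound :
    ∃ C : ℝ≥0, ∀ x : ℝ,
      ‖deriv Real.smoothTransition x‖ₑ ≤ (Set.Ioo (0 : ℝ) 1).indicator (fun _ => (C : ℝ≥0∞)) x := by
  have hc : Continuous (deriv Real.smoothTransition) :=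
    (Real.smoothTransition.contDiff (n := 1)).continuous_deriv le_rfl
  obtain ⟨C, hC⟩ := (isCompact_Icc (a := (0 : ℝ)) (b := 1)).exists_bound_of_continuousOn
    hc.continuousOn
  refine ⟨C.toNNReal, fun x => ?_⟩
  by_cases hx : x ∈ Set.Ioo (0 : ℝ) 1
  · rw [Set.indicator_of_mem hx, ← ofReal_norm]
    exact ENNReal.ofReal_le_ofReal (hC x (Set.Ioo_subset_Icc_self hx))
  · rw [Set.indicator_of_notMem hx, nonpos_iff_eq_zero, enorm_eq_zero]
    rcases le_or_gt x 0 with h | h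
    · refine IsLocalMin.deriv_eq_zero (Eventually.of_forall fun y => ?_)
      simpa [Real.smoothTransition.zero_of_nonpos h] using Real.smoothTransition.nonneg y
    · have h1 : 1 ≤ x := by
        by_contra! h1
        exact hx ⟨h, h1⟩
      refine IsLocalMax.deriv_eq_zero (Eventually.of_forall fun y => ?_)
      simpa [Real.smoothTransition.one_of_one_le h1] using Real.smoothTransition.le_one y

theorem ENNReal.tsum_liminf_le {ι : Type*} [Countable ι] (f : ℕ → ι → ℝ≥0∞) :
    ∑' i, liminf (fun k => f k i) atTop ≤ liminf (fun k => ∑' i, f k i) atTop := by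
  let _ : MeasurableSpace ι := ⊤
  simp only [← lintegral_count]
  exact lintegral_liminf_le fun k => measurable_of_countable _

/-- The density `(k + 1) |∇φ|` restricted to the slab `{t < φ < t + 1 / (k + 1)}`. -/
def slabGradient (φ : E → ℝ) (k : ℕ) (t : ℝ) (x : E) : ℝ≥0∞ :=
  (Set.Ioo (0 : ℝ) 1).indicator (fun _ => (k + 1 : ℝ≥0∞)) ((k + 1) * (φ x - t)) *
    ‖fderiv ℝ φ x‖ₑ

theorem measurable_slabGradient [MeasurableSpace E] [BorelSpace E] {φ : E → ℝ}
    (hφ : ContDiff ℝ 1 φ) (k : ℕ) :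
    Measurable fun p : E × ℝ => slabGradient φ k p.2 p.1 := by
  have h₁ : Continuous φ := hφ.continuous
  have h₂ : Continuous fun p : E × ℝ => ‖fderiv ℝ φ p.1‖ₑ :=
    ((hφ.continuous_fderiv one_ne_zero).comp continuous_fst).enorm
  have h₃ : Continuous fun p : E × ℝ => (k + 1 : ℝ) * (φ p.1 - p.2) := by fun_prop
  exact ((measurable_const.indicator measurableSet_Ioo).comp h₃.measurable).mul h₂.measurable

theorem lintegral_slabGradient {φ : E → ℝ} (k : ℕ) (x : E) :
    ∫⁻ t, slabGradient φ k t x = ‖fderiv ℝ φ x‖ₑ := by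
  have hk : (0 : ℝ) < k + 1 := by positivity
  have h : ∀ t, slabGradient φ k t x =
      (Set.Ioo (φ x - (k + 1 : ℝ)⁻¹) (φ x)).indicator
        (fun _ => (k + 1 : ℝ≥0∞) * ‖fderiv ℝ φ x‖ₑ) t := by
    intro t
    have hiff : (k + 1 : ℝ) * (φ x - t) ∈ Set.Ioo (0 : ℝ) 1 ↔
        t ∈ Set.Ioo (φ x - (k + 1 : ℝ)⁻¹) (φ x) := by
      rw [Set.mem_Ioo, Set.mem_Ioo, mul_pos_iff_of_pos_left hk, ← lt_inv_mul_iff₀ hk, mul_one,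
        sub_pos, sub_lt_comm, and_comm]
    by_cases ht : t ∈ Set.Ioo (φ x - (k + 1 : ℝ)⁻¹) (φ x)
    · rw [slabGradient, Set.indicator_of_mem (hiff.2 ht), Set.indicator_of_mem ht]
    · rw [slabGradient, Set.indicator_of_notMem (mt hiff.1 ht), Set.indicator_of_notMem ht,
        zero_mul]
  simp only [h]
  rw [lintegral_indicator measurableSet_Ioo, setLIntegral_const, Real.volume_Ioo, sub_sub_cancel,
    ENNReal.ofReal_inv_of_pos hk, ENNReal.ofReal_add k.cast_nonneg zero_le_one,
    ENNReal.ofReal_natCast, ENNReal.ofReal_one, mul_right_comm,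
    ENNReal.mul_inv_cancel (by positivity) (by finiteness), one_mul]

theorem enorm_fderiv_smoothTransition_comp_le {φ : E → ℝ} (hφ : ContDiff ℝ 1 φ) {C : ℝ≥0}
    (hC : ∀ x : ℝ, ‖deriv Real.smoothTransition x‖ₑ ≤
      (Set.Ioo (0 : ℝ) 1).indicator (fun _ => (C : ℝ≥0∞)) x) (k : ℕ) (t : ℝ) (x : E) :
    ‖fderiv ℝ (fun x => Real.smoothTransition ((k + 1) * (φ x - t))) x‖ₑ ≤
      C * slabGradient φ k t x := by
  have hd : HasFDerivAt (fun x => Real.smoothTransition ((k + 1) * (φ x - t)))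
      (deriv Real.smoothTransition ((k + 1) * (φ x - t)) • ((k + 1 : ℝ) • fderiv ℝ φ x)) x := by
    have h₁ : HasFDerivAt φ (fderiv ℝ φ x) x :=
      (hφ.differentiable one_ne_zero).differentiableAt.hasFDerivAt
    have h₂ : HasDerivAt Real.smoothTransition
        (deriv Real.smoothTransition ((k + 1) * (φ x - t))) ((k + 1) * (φ x - t)) :=
      ((Real.smoothTransition.contDiff (n := 1)).differentiable
        one_ne_zero).differentiableAt.hasDerivAt
    exact h₂.comp_hasFDerivAt x ((h₁.sub_const t).const_mul (k + 1 : ℝ))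
  rw [hd.fderiv, enorm_smul, enorm_smul, slabGradient, ← mul_assoc, ← mul_assoc]
  gcongr ?_ * _
  have hk : ‖(k + 1 : ℝ)‖ₑ = k + 1 := by
    rw [Real.enorm_eq_ofReal (by positivity), ENNReal.ofReal_add k.cast_nonneg zero_le_one,
      ENNReal.ofReal_natCast, ENNReal.ofReal_one]
  rw [hk]
  refine (mul_le_mul_left (hC _) _).trans (le_of_eq ?_)
  by_cases hx : (k + 1) * (φ x - t) ∈ Set.Ioo (0 : ℝ) 1 <;> simp [hx]

variable [FiniteDimensional ℝ E] [MeasurableSpace E] [BorelSpace E]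
  (ν : Measure E) [ν.IsAddHaarMeasure]

theorem lintegral_comp_smul_add (g : E → ℝ≥0∞) (hg : Measurable g) {c : ℝ} (hc : 0 < c) (z : E) :
    ∫⁻ x, g (c • x + z) ∂ν = ENNReal.ofReal ((c ^ Module.finrank ℝ E)⁻¹) * ∫⁻ x, g x ∂ν := by
  have h := lintegral_map (μ := ν) (f := fun x => g (x + z)) (g := fun x : E => c • x)
    (by fun_prop) (by fun_prop)
  rw [← h, Measure.map_addHaar_smul ν hc.ne', lintegral_smul_measure,
    lintegral_add_right_eq_self, smul_eq_mul, abs_of_pos (by positivity)]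

theorem setLIntegral_comp_smul_add_le (g : E → ℝ≥0∞) (hg : Measurable g) {c : ℝ} (hc : 1 / 2 ≤ c)
    (z : E) {B : Set E} (hB : MeasurableSet B) (hz : ∀ x ∈ B, c • x + z ∈ B) :
    ∫⁻ x in B, g (c • x + z) ∂ν ≤ 2 ^ Module.finrank ℝ E * ∫⁻ x in B, g x ∂ν := by
  have hc0 : 0 < c := by linarith
  calc ∫⁻ x in B, g (c • x + z) ∂ν
      ≤ ∫⁻ x, B.indicator g (c • x + z) ∂ν := by
        rw [← lintegral_indicator hB]
        refine lintegral_mono fun x => ?_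
        by_cases hx : x ∈ B
        · simp [hx, hz x hx]
        · simp [hx]
    _ = ENNReal.ofReal ((c ^ Module.finrank ℝ E)⁻¹) * ∫⁻ x in B, g x ∂ν := by
        rw [lintegral_comp_smul_add ν _ (hg.indicator hB) hc0, lintegral_indicator hB]
    _ ≤ _ := by
        gcongr
        rw [← ENNReal.ofReal_ofNat 2, ← ENNReal.ofReal_pow zero_le_two]
        refine ENNReal.ofReal_le_ofReal ?_
        rw [← inv_pow]
        gcongr
        rw [inv_le_comm₀ hc0 two_pos]
        linarith

/-- The averaged Poincaré inequality on a ball. -/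
theorem lintegral_enorm_sub_ball_le {v : E → ℝ} (hv : ContDiff ℝ 1 v) (a : E) (r : ℝ) :
    ∫⁻ p, ‖v p.1 - v p.2‖ₑ
        ∂((ν.restrict (Metric.ball a r)).prod (ν.restrict (Metric.ball a r))) ≤
      2 ^ Module.finrank ℝ E * ENNReal.ofReal (2 * r) * ν (Metric.ball a r) *
        ∫⁻ x in Metric.ball a r, ‖fderiv ℝ v x‖ₑ ∂ν := by
  set B := Metric.ball a r
  set g : E → ℝ≥0∞ := fun x => ‖fderiv ℝ v x‖ₑ
  have hgc : Continuous g := (hv.continuous_fderiv one_ne_zero).enorm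
  have hB : MeasurableSet B := measurableSet_ball
  have hconv : Convex ℝ B := convex_ball a r
  have hvc := hv.continuous
  have hmean : ∀ s ∈ Set.Icc (0 : ℝ) 1, ∫⁻ x in B, ∫⁻ y in B, g (s • x + (1 - s) • y) ∂ν ∂ν ≤
      2 ^ Module.finrank ℝ E * ν B * ∫⁻ x in B, g x ∂ν := by
    intro s hs
    have key : ∀ s ∈ Set.Icc (1 / 2 : ℝ) 1,
        ∫⁻ y in B, ∫⁻ x in B, g (s • x + (1 - s) • y) ∂ν ∂ν ≤
          2 ^ Module.finrank ℝ E * ν B * ∫⁻ x in B, g x ∂ν := by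
      intro s hs
      calc ∫⁻ y in B, ∫⁻ x in B, g (s • x + (1 - s) • y) ∂ν ∂ν
          ≤ ∫⁻ y in B, 2 ^ Module.finrank ℝ E * ∫⁻ x in B, g x ∂ν ∂ν := by
            refine setLIntegral_mono measurable_const fun y hy => ?_
            exact setLIntegral_comp_smul_add_le ν g hgc.measurable hs.1 _ hB fun x hx =>
              hconv hx hy (by linarith [hs.1]) (by linarith [hs.2]) (by ring)
        _ = _ := by rw [setLIntegral_const]; ring
    rcases le_total (1 / 2) s with h | h
    · rw [lintegral_lintegral_swap]
      · exact key s ⟨h, hs.2⟩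
      · exact Continuous.aemeasurable (by unfold Function.uncurry; fun_prop)
    · have := key (1 - s) ⟨by linarith, by linarith [hs.1]⟩
      simpa only [sub_sub_cancel, add_comm] using this
  have hm : Measurable fun q : (E × E) × ℝ => g (q.2 • q.1.1 + (1 - q.2) • q.1.2) :=
    Continuous.measurable (by fun_prop)
  have hprod : ∀ᵐ p ∂((ν.restrict B).prod (ν.restrict B)), p.1 ∈ B ∧ p.2 ∈ B := by
    rw [Measure.prod_restrict]
    exact ae_restrict_mem (hB.prod hB)
  calc ∫⁻ p, ‖v p.1 - v p.2‖ₑ ∂((ν.restrict B).prod (ν.restrict B))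
      ≤ ∫⁻ p, (∫⁻ s in Set.Icc (0 : ℝ) 1, g (s • p.1 + (1 - s) • p.2)) * ENNReal.ofReal (2 * r)
          ∂((ν.restrict B).prod (ν.restrict B)) := by
        refine lintegral_mono_ae (hprod.mono fun p hp => ?_)
        refine (enorm_sub_le_lintegral_fderiv_segment hv p.1 p.2).trans ?_
        rw [lintegral_mul_const _ (Continuous.measurable (by fun_prop))]
        gcongr
        rw [← ofReal_norm, ← dist_eq_norm]
        refine ENNReal.ofReal_le_ofReal ?_
        have h₁ := Metric.mem_ball.1 hp.1
        have h₂ := Metric.mem_ball.1 hp.2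
        linarith [dist_triangle_right p.1 p.2 a]
    _ = (∫⁻ s in Set.Icc (0 : ℝ) 1, ∫⁻ x in B, ∫⁻ y in B, g (s • x + (1 - s) • y) ∂ν ∂ν) *
          ENNReal.ofReal (2 * r) := by
        rw [lintegral_mul_const _ hm.lintegral_prod_right', lintegral_lintegral_swap hm.aemeasurable]
        congr 1
        refine lintegral_congr fun s => ?_
        rw [lintegral_prod _ (Continuous.aemeasurable (by fun_prop))]
    _ ≤ (∫⁻ s in Set.Icc (0 : ℝ) 1, 2 ^ Module.finrank ℝ E * ν B * ∫⁻ x in B, g x ∂ν) *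
          ENNReal.ofReal (2 * r) := by
        gcongr ?_ * _
        exact setLIntegral_mono measurable_const hmean
    _ = _ := by
        rw [setLIntegral_const]
        simp only [Real.volume_Icc, sub_zero, ENNReal.ofReal_one]
        ring

theorem lintegral_liminf_slabGradient_le {φ : E → ℝ} (hφ : ContDiff ℝ 1 φ) :
    ∫⁻ t, liminf (fun k => ∫⁻ x, slabGradient φ k t x ∂ν) atTop ≤
      ∫⁻ x, ‖fderiv ℝ φ x‖ₑ ∂ν := by
  refine (lintegral_liminf_le fun k => (measurable_slabGradient hφ k).lintegral_prod_left').trans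
    (le_of_eq ?_)
  have h : ∀ k, ∫⁻ t, ∫⁻ x, slabGradient φ k t x ∂ν = ∫⁻ x, ‖fderiv ℝ φ x‖ₑ ∂ν := fun k => by
    rw [← lintegral_lintegral_swap (measurable_slabGradient hφ k).aemeasurable]
    simp only [lintegral_slabGradient]
  simp only [h, liminf_const]

/-- A relative isoperimetric inequality for superlevel sets in balls. -/
theorem exists_measure_mul_measure_superlevel_le :
    ∃ C : ℝ≥0, ∀ φ : E → ℝ, ContDiff ℝ 1 φ → ∀ (t : ℝ) (a : E) (r : ℝ),
      ν (Metric.ball a r ∩ {x | t < φ x}) * ν (Metric.ball a r \ {x | t < φ x}) ≤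
        C * ENNReal.ofReal r * ν (Metric.ball a r) *
          liminf (fun k => ∫⁻ x in Metric.ball a r, slabGradient φ k t x ∂ν) atTop := by
  obtain ⟨C, hC⟩ := exists_deriv_smoothTransition_bound
  refine ⟨2 ^ Module.finrank ℝ E * 2 * C, fun φ hφ t a r => ?_⟩
  set B := Metric.ball a r
  have hB : MeasurableSet B := measurableSet_ball
  have hφc := hφ.continuous
  have hE : MeasurableSet {x | t < φ x} := (isOpen_lt continuous_const hφc).measurableSet
  set v : ℕ → E → ℝ := fun k x => Real.smoothTransition ((k + 1) * (φ x - t))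
  have hvd : ∀ k, ContDiff ℝ 1 (v k) := fun k =>
    Real.smoothTransition.contDiff.comp (contDiff_const.mul (hφ.sub contDiff_const))
  have hlim : ∀ p : E × E, p ∈ {x | t < φ x} ×ˢ {x | t < φ x}ᶜ →
      1 ≤ liminf (fun k => ‖v k p.1 - v k p.2‖ₑ) atTop := by
    rintro ⟨x, y⟩ ⟨hx, hy⟩
    simp only [Set.mem_compl_iff, Set.mem_ofPred_eq, not_lt] at hx hy
    have hxt : 0 < φ x - t := sub_pos.2 hx
    refine le_liminf_of_le (by isBoundedDefault) ?_
    filter_upwards [(tendsto_natCast_atTop_atTop (R := ℝ)).eventually_ge_atTop (φ x - t)⁻¹]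
      with k hk
    have h₁ : v k x = 1 := Real.smoothTransition.one_of_one_le <| by
      have : (φ x - t)⁻¹ * (φ x - t) = 1 := inv_mul_cancel₀ hxt.ne'
      nlinarith
    have h₂ : v k y = 0 := Real.smoothTransition.zero_of_nonpos <|
      mul_nonpos_of_nonneg_of_nonpos (by positivity) (by linarith)
    simp [h₁, h₂]
  calc ν (B ∩ {x | t < φ x}) * ν (B \ {x | t < φ x})
      = ((ν.restrict B).prod (ν.restrict B)) ({x | t < φ x} ×ˢ {x | t < φ x}ᶜ) := by
        rw [Measure.prod_prod, Measure.restrict_apply hE, Measure.restrict_apply hE.compl,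
          Set.inter_comm, Set.sdiff_eq, Set.inter_comm B {x | t < φ x}ᶜ]
    _ ≤ ∫⁻ p, liminf (fun k => ‖v k p.1 - v k p.2‖ₑ) atTop
          ∂((ν.restrict B).prod (ν.restrict B)) := by
        rw [← lintegral_indicator_one (hE.prod hE.compl)]
        refine lintegral_mono fun p => Set.indicator_le' (fun p hp => hlim p hp)
          (fun _ _ => zero_le) p
    _ ≤ liminf (fun k => ∫⁻ p, ‖v k p.1 - v k p.2‖ₑ
          ∂((ν.restrict B).prod (ν.restrict B))) atTop := by
        refine lintegral_liminf_le fun k => Continuous.measurable ?_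
        have := (hvd k).continuous
        fun_prop
    _ ≤ liminf (fun k => 2 ^ Module.finrank ℝ E * ENNReal.ofReal (2 * r) * ν B * C *
          ∫⁻ x in B, slabGradient φ k t x ∂ν) atTop := by
        refine liminf_le_liminf (Eventually.of_forall fun k => ?_)
        refine (lintegral_enorm_sub_ball_le ν (hvd k) a r).trans ?_
        rw [mul_assoc _ (C : ℝ≥0∞), ← lintegral_const_mul' (C : ℝ≥0∞) _ (by finiteness)]
        refine mul_le_mul_right (lintegral_mono fun x => ?_) _
        exact enorm_fderiv_smoothTransition_comp_le hφ hC k t x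
    _ = _ := by
        have hfin : ν B ≠ ∞ := measure_ball_lt_top.ne
        rw [ENNReal.liminf_const_mul_of_ne_top (by finiteness), ENNReal.ofReal_mul zero_le_two]
        push_cast
        rw [ENNReal.ofReal_ofNat]
        ring

/-- Every point of an open set of finite measure is the center of a ball, of uniformly bounded
radius, in which both the set and its complement have a definite density. -/
theorem exists_ball_measure_le_inter_and_diff [Nontrivial E] {s : Set E} (hs : IsOpen s)
    (hfin : ν s ≠ ∞) :
    ∃ R : ℝ, ∀ x ∈ s, ∃ r : ℝ, 0 < r ∧ r ≤ R ∧
      ν (Metric.ball x r) ≤ 2 ^ (Module.finrank ℝ E + 1) * ν (Metric.ball x r ∩ s) ∧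
      ν (Metric.ball x r) ≤ 2 * ν (Metric.ball x r \ s) := by
  set d := Module.finrank ℝ E
  have hdpos : d ≠ 0 := Module.finrank_pos.ne'
  set m := ν (Metric.ball 0 1)
  have hm0 : m ≠ 0 := (Metric.measure_ball_pos ν 0 one_pos).ne'
  have hmt : m ≠ ∞ := measure_ball_lt_top.ne
  set q : ℝ≥0∞ := 2 * ν s / m
  have hqt : q ≠ ∞ := ENNReal.div_ne_top (by finiteness) hm0
  set R : ℝ := q.toReal + 1 with hR
  have hR1 : 1 ≤ R := by simp [hR]
  have hR0 : 0 < R := one_pos.trans_le hR1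
  have hRs : 2 * ν s < ENNReal.ofReal (R ^ d) * m := by
    calc 2 * ν s = q * m := (ENNReal.div_mul_cancel hm0 hmt).symm
      _ < ENNReal.ofReal R * m := by
        refine ENNReal.mul_lt_mul_left hm0 hmt ?_
        rw [ENNReal.lt_ofReal_iff_toReal_lt hqt]
        simp [hR]
      _ ≤ _ := by
        gcongr
        exact le_self_pow₀ hR1 hdpos
  refine ⟨R, fun x hx => ?_⟩
  have hex : ∃ k : ℕ, ν (Metric.ball x (R / 2 ^ k)) ≤ 2 * ν (Metric.ball x (R / 2 ^ k) ∩ s) := by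
    obtain ⟨ε, hε, hεs⟩ := Metric.isOpen_iff.1 hs x hx
    obtain ⟨k, hk⟩ := pow_unbounded_of_one_lt (R / ε) (one_lt_two (α := ℝ))
    have hkε : R / 2 ^ k ≤ ε := by
      rw [div_lt_iff₀ hε] at hk
      rw [div_le_iff₀ (by positivity)]
      linarith
    refine ⟨k, ?_⟩
    rw [Set.inter_eq_self_of_subset_left ((Metric.ball_subset_ball hkε).trans hεs)]
    exact le_mul_of_one_le_left' one_le_two
  classical
  have hspec := Nat.find_spec hex
  have hmin := fun j => Nat.find_min hex (m := j)
  generalize Nat.find hex = k at hspec hmin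
  have hk0 : k ≠ 0 := by
    rintro rfl
    rw [pow_zero, div_one, Measure.addHaar_ball_of_pos ν x hR0] at hspec
    refine (hspec.trans ?_).not_gt hRs
    gcongr
    exact Set.inter_subset_right
  obtain ⟨j, rfl⟩ := Nat.exists_eq_succ_of_ne_zero hk0
  have hj := not_le.1 (hmin j j.lt_succ_self)
  set r : ℝ := R / 2 ^ j with hr
  have hr0 : 0 < r := by positivity
  have hhalf : R / 2 ^ j.succ = r / 2 := by rw [hr, pow_succ, div_div]
  rw [hhalf] at hspec
  refine ⟨r, hr0, div_le_self hR0.le (one_le_pow₀ one_le_two), ?_, ?_⟩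
  · calc ν (Metric.ball x r) = 2 ^ d * ν (Metric.ball x (r / 2)) := by
          have h2r : r = 2 * (r / 2) := by ring
          conv_lhs => rw [h2r]
          rw [Measure.addHaar_ball_mul_of_pos ν x two_pos,
            Measure.addHaar_ball_center ν x (r / 2), ENNReal.ofReal_pow zero_le_two,
            ENNReal.ofReal_ofNat]
      _ ≤ 2 ^ d * (2 * ν (Metric.ball x r ∩ s)) := by
          gcongr
          refine hspec.trans ?_
          gcongr
          linarith
      _ = _ := by ring
  · have hadd := measure_inter_add_sdiff (μ := ν) (Metric.ball x r) hs.measurableSet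
    have h1 : ν (Metric.ball x r) ≠ ∞ := measure_ball_lt_top.ne
    refine (ENNReal.add_le_add_iff_left h1).1 ?_
    calc ν (Metric.ball x r) + ν (Metric.ball x r)
        = 2 * ν (Metric.ball x r ∩ s) + 2 * ν (Metric.ball x r \ s) := by
          rw [← mul_add, hadd, two_mul]
      _ ≤ _ := by gcongr

theorem exists_radius_pow_le_liminf_slabGradient {n : ℕ} (hn : Module.finrank ℝ E = n + 1) :
    ∃ M : ℝ≥0∞, M ≠ ∞ ∧ ∀ φ : E → ℝ, ContDiff ℝ 1 φ → HasCompactSupport φ → ∀ t : ℝ, 0 < t →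
      ∃ R : ℝ, ∀ x, t < φ x → ∃ r : ℝ, 0 < r ∧ r ≤ R ∧
        ENNReal.ofReal (r ^ n) ≤
          M * liminf (fun k => ∫⁻ y in Metric.ball x r, slabGradient φ k t y ∂ν) atTop := by
  have : Nontrivial E := Module.nontrivial_of_finrank_pos (R := ℝ) (by omega)
  obtain ⟨C, hC⟩ := exists_measure_mul_measure_superlevel_le ν
  set m := ν (Metric.ball 0 1)
  have hm0 : m ≠ 0 := (Metric.measure_ball_pos ν 0 one_pos).ne'
  have hmt : m ≠ ∞ := measure_ball_lt_top.ne
  refine ⟨m⁻¹ * (2 ^ (n + 3) * C), by finiteness, fun φ hφ hφs t ht => ?_⟩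
  have hopen : IsOpen {x | t < φ x} := isOpen_lt continuous_const hφ.continuous
  have hfin : ν {x | t < φ x} ≠ ∞ := by
    refine ((measure_mono fun x hx => ?_).trans_lt hφs.isCompact.measure_lt_top).ne
    exact subset_tsupport φ (ht.trans hx).ne'
  obtain ⟨R, hR⟩ := exists_ball_measure_le_inter_and_diff ν hopen hfin
  refine ⟨R, fun x hx => ?_⟩
  obtain ⟨r, hr, hrR, h₁, h₂⟩ := hR x hx
  refine ⟨r, hr, hrR, ?_⟩
  have h₃ := hC φ hφ t x r
  have hV : ν (Metric.ball x r) = ENNReal.ofReal r * (ENNReal.ofReal (r ^ n) * m) := by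
    rw [Measure.addHaar_ball_of_pos ν x hr, hn, pow_succ', ENNReal.ofReal_mul hr.le, mul_assoc]
  have hV0 : ν (Metric.ball x r) ≠ 0 := (Metric.measure_ball_pos ν x hr).ne'
  have hVt : ν (Metric.ball x r) ≠ ∞ := measure_ball_lt_top.ne
  set L := liminf (fun k => ∫⁻ y in Metric.ball x r, slabGradient φ k t y ∂ν) atTop
  set V := ν (Metric.ball x r)
  have h₄ : V * V ≤ V * (ENNReal.ofReal r * (2 ^ (n + 3) * C * L)) := by
    calc V * V ≤ (2 ^ (n + 1 + 1) * ν (Metric.ball x r ∩ {x | t < φ x})) *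
            (2 * ν (Metric.ball x r \ {x | t < φ x})) := by
          rw [hn] at h₁
          gcongr
      _ = 2 ^ (n + 3) * (ν (Metric.ball x r ∩ {x | t < φ x}) *
            ν (Metric.ball x r \ {x | t < φ x})) := by ring
      _ ≤ 2 ^ (n + 3) * (C * ENNReal.ofReal r * V * L) := by gcongr
      _ = _ := by ring
  have h₅ := (ENNReal.mul_le_mul_iff_right hV0 hVt).1 h₄
  rw [hV, ENNReal.mul_le_mul_iff_right (by simpa using hr) ENNReal.ofReal_ne_top] at h₅
  calc ENNReal.ofReal (r ^ n) = m⁻¹ * (ENNReal.ofReal (r ^ n) * m) := by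
        rw [mul_comm, mul_assoc, ENNReal.mul_inv_cancel hm0 hmt, mul_one]
    _ ≤ m⁻¹ * (2 ^ (n + 3) * C * L) := by gcongr
    _ = _ := by ring

/-- The boxing inequality for superlevel sets, integrated against a measure of codimension one
growth. -/
theorem exists_measure_superlevel_le {n : ℕ} (hn : Module.finrank ℝ E = n + 1) :
    ∃ M : ℝ≥0∞, M ≠ ∞ ∧ ∀ (μ : Measure E) (K : ℝ), 0 ≤ K →
      (∀ (x : E) (r : ℝ), 0 < r → μ (Metric.ball x r) ≤ ENNReal.ofReal (K * r ^ n)) →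
      ∀ φ : E → ℝ, ContDiff ℝ 1 φ → HasCompactSupport φ → ∀ t : ℝ, 0 < t →
        μ {x | t < φ x} ≤
          M * ENNReal.ofReal K * liminf (fun k => ∫⁻ x, slabGradient φ k t x ∂ν) atTop := by
  obtain ⟨M, hM, h⟩ := exists_radius_pow_le_liminf_slabGradient ν hn
  refine ⟨6 ^ n * M, by finiteness, fun μ K hK hμ φ hφ hφs t ht => ?_⟩
  obtain ⟨R, hR⟩ := h φ hφ hφs t ht
  choose! r hr hrR hrM using hR
  obtain ⟨u, hus, hdisj, hcov⟩ := Vitali.exists_disjoint_subfamily_covering_enlargement_closedBall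
    {x | t < φ x} id r R hrR 5 (by norm_num)
  have hdisj' : u.PairwiseDisjoint fun x => Metric.ball x (r x) :=
    hdisj.mono fun x => Metric.ball_subset_closedBall
  have hcount : u.Countable := hdisj'.countable_of_isOpen (fun _ _ => Metric.isOpen_ball)
    fun x hx => Metric.nonempty_ball.2 (hr x (hus hx))
  have : Countable u := hcount.to_subtype
  have hsub : {x | t < φ x} ⊆ ⋃ x ∈ u, Metric.ball x (6 * r x) := fun x hx => by
    obtain ⟨b, hb, hxb⟩ := hcov x hx
    have hrb := hr b (hus hb)
    exact Set.mem_iUnion₂.2 ⟨b, hb, Metric.closedBall_subset_ball (by linarith)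
      (hxb (Metric.mem_closedBall_self (hr x hx).le))⟩
  calc μ {x | t < φ x} ≤ ∑' x : u, μ (Metric.ball x (6 * r x)) :=
        (measure_mono hsub).trans (measure_biUnion_le μ hcount _)
    _ ≤ ∑' x : u, 6 ^ n * M * ENNReal.ofReal K *
          liminf (fun k => ∫⁻ y in Metric.ball x (r x), slabGradient φ k t y ∂ν) atTop := by
        refine ENNReal.tsum_le_tsum fun x => ?_
        have hrx := hr x (hus x.2)
        refine (hμ x _ (by positivity)).trans ?_
        rw [mul_pow, ENNReal.ofReal_mul hK, ENNReal.ofReal_mul (by positivity),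
          ENNReal.ofReal_pow (by norm_num), ENNReal.ofReal_ofNat]
        calc ENNReal.ofReal K * (6 ^ n * ENNReal.ofReal (r x ^ n))
            ≤ ENNReal.ofReal K * (6 ^ n * (M * liminf (fun k =>
                ∫⁻ y in Metric.ball (x : E) (r x), slabGradient φ k t y ∂ν) atTop)) := by
              gcongr
              exact hrM x (hus x.2)
          _ = _ := by ring
    _ ≤ 6 ^ n * M * ENNReal.ofReal K * liminf (fun k =>
          ∑' x : u, ∫⁻ y in Metric.ball x (r x), slabGradient φ k t y ∂ν) atTop := by
        rw [ENNReal.tsum_mul_left]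
        gcongr
        exact ENNReal.tsum_liminf_le _
    _ ≤ _ := by
        refine mul_le_mul_right (liminf_le_liminf (Eventually.of_forall fun k => ?_)) _
        rw [← lintegral_biUnion hcount (fun _ _ => measurableSet_ball) hdisj']
        exact setLIntegral_le_lintegral _ _

theorem exists_lintegral_ofReal_le_lintegral_fderiv {n : ℕ} (hn : Module.finrank ℝ E = n + 1) :
    ∃ M : ℝ≥0∞, M ≠ ∞ ∧ ∀ (μ : Measure E) (K : ℝ), 0 ≤ K →
      (∀ (x : E) (r : ℝ), 0 < r → μ (Metric.ball x r) ≤ ENNReal.ofReal (K * r ^ n)) →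
      ∀ φ : E → ℝ, ContDiff ℝ 1 φ → HasCompactSupport φ →
        ∫⁻ x, ENNReal.ofReal (φ x) ∂μ ≤
          M * ENNReal.ofReal K * ∫⁻ x, ‖fderiv ℝ φ x‖ₑ ∂ν := by
  obtain ⟨M, hM, h⟩ := exists_measure_superlevel_le ν hn
  refine ⟨M, hM, fun μ K hK hμ φ hφ hφs => ?_⟩
  have hφc := hφ.continuous
  calc ∫⁻ x, ENNReal.ofReal (φ x) ∂μ = ∫⁻ x, ENNReal.ofReal (max (φ x) 0) ∂μ := by simp
    _ = ∫⁻ t in Set.Ioi 0, μ {x | t < max (φ x) 0} :=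
        lintegral_eq_lintegral_meas_lt μ (Eventually.of_forall fun x => le_max_right _ _)
          (Continuous.aemeasurable (by fun_prop))
    _ ≤ ∫⁻ t in Set.Ioi 0, M * ENNReal.ofReal K *
          liminf (fun k => ∫⁻ x, slabGradient φ k t x ∂ν) atTop := by
        refine lintegral_mono_ae ((ae_restrict_mem measurableSet_Ioi).mono fun t ht => ?_)
        have hset : {x | t < max (φ x) 0} = {x | t < φ x} := by
          ext x
          simp [(Set.mem_Ioi.1 ht).not_gt]
        rw [hset]
        exact h μ K hK hμ φ hφ hφs t ht
    _ ≤ _ := by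
        rw [lintegral_const_mul' _ _ (by finiteness)]
        gcongr
        exact (setLIntegral_le_lintegral _ _).trans (lintegral_liminf_slabGradient_le ν hφ)

end TraceInequality

/-- Meyers–Ziemer trace inequality: if `μ(B_r(x)) ≤ K rⁿ` for all balls in `ℝ^{n+1}`, then
`|∫ φ dμ| ≤ c(n) K ∫ |∇φ| dL^{n+1}` for all `φ ∈ C¹_c(ℝ^{n+1})`. -/
theorem stmt4 (n : ℕ) :
    ∃ c : ℝ, 0 < c ∧ ∀ (μ : Measure (Euc (n + 1))) (K : ℝ), 0 ≤ K →
      (∀ (x : Euc (n + 1)) (r : ℝ), 0 < r → μ (Metric.ball x r) ≤ ENNReal.ofReal (K * r ^ n)) →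
      ∀ φ : Euc (n + 1) → ℝ, ContDiff ℝ 1 φ → HasCompactSupport φ →
        |∫ x, φ x ∂μ| ≤ c * K * ∫ x, ‖fderiv ℝ φ x‖ := by
  obtain ⟨M, hM, h⟩ := exists_lintegral_ofReal_le_lintegral_fderiv
    (volume : Measure (Euc (n + 1))) (n := n) (by simp)
  refine ⟨2 * M.toReal + 1, by positivity, fun μ K hK hμ φ hφ hφs => ?_⟩
  have hint : Integrable (fun x => ‖fderiv ℝ φ x‖) :=
    ((hφ.continuous_fderiv one_ne_zero).norm).integrable_of_hasCompactSupport (hφs.fderiv ℝ).norm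
  set I := ∫ x, ‖fderiv ℝ φ x‖ with hI
  have hI0 : 0 ≤ I := integral_nonneg fun _ => norm_nonneg _
  have hIe : ∫⁻ x, ‖fderiv ℝ φ x‖ₑ = ENNReal.ofReal I := by
    rw [hI, ofReal_integral_eq_lintegral_ofReal hint (Eventually.of_forall fun _ => norm_nonneg _)]
    simp only [ofReal_norm]
  have hpos := h μ K hK hμ φ hφ hφs
  have hneg := h μ K hK hμ (fun x => -φ x) hφ.neg hφs.neg
  simp only [fderiv_fun_neg, enorm_neg] at hneg
  rw [hIe] at hpos hneg
  have hle : ‖∫ x, φ x ∂μ‖ₑ ≤ ENNReal.ofReal (2 * M.toReal * K * I) := by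
    calc ‖∫ x, φ x ∂μ‖ₑ ≤ ∫⁻ x, ‖φ x‖ₑ ∂μ := enorm_integral_le_lintegral_enorm _
      _ ≤ ∫⁻ x, ENNReal.ofReal (φ x) + ENNReal.ofReal (-φ x) ∂μ := by
          refine lintegral_mono fun x => ?_
          rcases le_total 0 (φ x) with hx | hx
          · rw [Real.enorm_eq_ofReal hx]
            exact le_self_add
          · rw [← enorm_neg, Real.enorm_eq_ofReal (neg_nonneg.2 hx)]
            exact le_add_self
      _ = ∫⁻ x, ENNReal.ofReal (φ x) ∂μ + ∫⁻ x, ENNReal.ofReal (-φ x) ∂μ :=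
          lintegral_add_left hφ.continuous.measurable.ennreal_ofReal _
      _ ≤ M * ENNReal.ofReal K * ENNReal.ofReal I + M * ENNReal.ofReal K * ENNReal.ofReal I :=
          add_le_add hpos hneg
      _ = _ := by
          rw [ENNReal.ofReal_mul (by positivity), ENNReal.ofReal_mul (by positivity),
            ENNReal.ofReal_mul zero_le_two, ENNReal.ofReal_toReal hM, ENNReal.ofReal_ofNat]
          ring
  rw [← Real.norm_eq_abs, ← toReal_enorm]
  refine (ENNReal.toReal_le_of_le_ofReal (by positivity) hle).trans ?_
  gcongr
  linarith
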